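/- Let s ≥ 0 and ε > 0, and set s̃ = s + 1/2 + ε. Let T be a bounded operator on a Banach space X with ‖T^n‖ ≤ C(1+n)^s for all n ≥ 0. Then the map Φ(f) = ∑_{n≥0} f̂(n) T^n defines a continuous unital algebra homomorphism from Λ_{s̃}^+(𝕋) to B(X) with Φ(z↦z) = T. -/

import Mathlib

open Real

/-- Fourier coefficient of a `2π`-periodic function `f : ℝ → ℂ`. -/
noncomputable def fourierCoeffR (f : ℝ → ℂ) (n : ℤ) : ℂ :=
  (1 / (2 * Real.pi)) * ∫ t in (0:ℝ)..(2 * Real.pi), f t * Complex.exp (-(n : ℂ) * t * Complex.I)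

/-- Membership in the Hölder class `Λ_s(𝕋)`. -/
def memLambda (s : ℝ) (f : ℝ → ℂ) : Prop :=
  Function.Periodic f (2 * Real.pi) ∧ ContDiff ℝ (⌊s⌋₊ : ℕ) f ∧
    ∃ M : ℝ, ∀ t t' : ℝ, ‖iteratedDeriv ⌊s⌋₊ f t - iteratedDeriv ⌊s⌋₊ f t'‖ ≤
      M * ‖Complex.exp (t * Complex.I) - Complex.exp (t' * Complex.I)‖ ^ (s - (⌊s⌋₊ : ℝ))

/-- Membership in the analytic subalgebra `Λ_s^+(𝕋)`. -/
def memLambdaPlus (s : ℝ) (f : ℝ → ℂ) : Prop :=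
  memLambda s f ∧ ∀ n : ℤ, n < 0 → fourierCoeffR f n = 0

/-- The norm of `Λ_s(𝕋)`. -/
noncomputable def lambdaNorm (s : ℝ) (f : ℝ → ℂ) : ℝ :=
  (∑ k ∈ Finset.range (⌊s⌋₊ + 1), sSup {x : ℝ | ∃ t : ℝ, x = ‖iteratedDeriv k f t‖}) +
    sSup {x : ℝ | ∃ t t' : ℝ,
      Complex.exp (t * Complex.I) ≠ Complex.exp (t' * Complex.I) ∧
      x = ‖iteratedDeriv ⌊s⌋₊ f t - iteratedDeriv ⌊s⌋₊ f t'‖ /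
        ‖Complex.exp (t * Complex.I) - Complex.exp (t' * Complex.I)‖ ^ (s - (⌊s⌋₊ : ℝ))}


lemma two_pi_pos' : (0:ℝ) < 2 * Real.pi := by positivity

lemma fcR_eq (f : ℝ → ℂ) (n : ℤ) :
    fourierCoeffR f n = fourierCoeffOn two_pi_pos' f n := by
  rw [fourierCoeffOn_eq_integral, fourierCoeffR, Complex.real_smul]
  congr 1
  · push_cast; ring
  · refine intervalIntegral.integral_congr fun x _ => ?_
    simp only [fourier_coe_apply, smul_eq_mul]
    rw [mul_comm]
    congr 2
    have : (Real.pi : ℂ) ≠ 0 := by exact_mod_cast Real.pi_ne_zero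
    push_cast
    field_simp
    simp
    ring

lemma fcR_add {f g : ℝ → ℂ} (hf : Continuous f) (hg : Continuous g) (n : ℤ) :
    fourierCoeffR (f + g) n = fourierCoeffR f n + fourierCoeffR g n := by
  simp only [fourierCoeffR, Pi.add_apply, add_mul]
  rw [intervalIntegral.integral_add, mul_add]
  all_goals exact Continuous.intervalIntegrable (by fun_prop) _ _

lemma fcR_smul (c : ℂ) (f : ℝ → ℂ) (n : ℤ) :
    fourierCoeffR (c • f) n = c * fourierCoeffR f n := by
  simp only [fourierCoeffR, Pi.smul_apply, smul_eq_mul, mul_assoc]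
  rw [intervalIntegral.integral_const_mul]
  ring

lemma fcR_sub {f g : ℝ → ℂ} (hf : Continuous f) (hg : Continuous g) (n : ℤ) :
    fourierCoeffR (fun t => f t - g t) n = fourierCoeffR f n - fourierCoeffR g n := by
  simp only [fourierCoeffR, sub_mul]
  rw [intervalIntegral.integral_sub, mul_sub]
  all_goals exact Continuous.intervalIntegrable (by fun_prop) _ _

lemma fcR_shift {f : ℝ → ℂ} (hp : Function.Periodic f (2 * Real.pi)) (h : ℝ) (n : ℤ) :
    fourierCoeffR (fun t => f (t + h)) n = Complex.exp (Complex.I * ((n * h : ℝ) : ℂ)) * fourierCoeffR f n := by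
  simp only [fourierCoeffR]
  have hper : Function.Periodic (fun t : ℝ => f t * Complex.exp (-(n : ℂ) * t * Complex.I)) (2 * Real.pi) := by
    intro t
    simp only [hp t]
    congr 1
    rw [Complex.exp_eq_exp_iff_exists_int]
    exact ⟨-n, by push_cast; ring⟩
  have h1 : ∀ t : ℝ, f (t + h) * Complex.exp (-(n : ℂ) * t * Complex.I) =
      Complex.exp (Complex.I * ((n * h : ℝ) : ℂ)) *
      (fun t : ℝ => f t * Complex.exp (-(n : ℂ) * t * Complex.I)) (t + h) := by
    intro t
    simp only
    rw [mul_left_comm, ← Complex.exp_add]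
    congr 2
    push_cast; ring
  simp_rw [h1]
  rw [intervalIntegral.integral_const_mul,
    intervalIntegral.integral_comp_add_right (fun t : ℝ => f t * Complex.exp (-(n : ℂ) * t * Complex.I)) h]
  rw [zero_add, add_comm (2 * Real.pi) h, hper.intervalIntegral_add_eq h 0, zero_add]
  ring

lemma bessel {f : ℝ → ℂ} (hf : Continuous f) {B : ℝ} (hB : ∀ t, ‖f t‖ ≤ B) (F : Finset ℤ) :
    ∑ n ∈ F, ‖fourierCoeffR f n‖ ^ 2 ≤ B ^ 2 := by
  have hL : MeasureTheory.MemLp f 2 (MeasureTheory.volume.restrict (Set.Ioc 0 (2 * Real.pi))) :=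
    MeasureTheory.MemLp.of_bound hf.aestronglyMeasurable B (Filter.Eventually.of_forall hB)
  have h := hasSum_sq_fourierCoeffOn two_pi_pos' hL
  simp_rw [fcR_eq]
  refine (sum_le_hasSum F (fun _ _ => by positivity) h).trans ?_
  have : ∫ x in (0:ℝ)..(2 * Real.pi), ‖f x‖ ^ 2 ≤ ∫ x in (0:ℝ)..(2 * Real.pi), B ^ 2 := by
    apply intervalIntegral.integral_mono_on two_pi_pos'.le
    · exact Continuous.intervalIntegrable (by fun_prop) _ _
    · exact Continuous.intervalIntegrable (by fun_prop) _ _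
    · intro x _
      have := hB x
      gcongr
  rw [intervalIntegral.integral_const] at this
  simp only [smul_eq_mul, sub_zero] at this ⊢
  rw [inv_mul_le_iff₀ two_pi_pos']
  exact this

lemma per_deriv {f : ℝ → ℂ} {c : ℝ} (hp : Function.Periodic f c) (k : ℕ) :
    Function.Periodic (iteratedDeriv k f) c := by
  induction k with
  | zero => simpa using hp
  | succ k ih =>
    intro x
    rw [iteratedDeriv_succ, ← deriv_comp_add_const]
    congr 1
    ext y
    exact ih y

lemma fcR_deriv {f : ℝ → ℂ} {m : ℕ} (hp : Function.Periodic f (2 * Real.pi))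
    (hf : ContDiff ℝ m f) {n : ℤ} (hn : n ≠ 0) :
    ‖fourierCoeffR (iteratedDeriv m f) n‖ = |(n:ℝ)| ^ m * ‖fourierCoeffR f n‖ := by
  induction m with
  | zero => simp
  | succ m ih =>
    have h1 := ih (hf.of_le (by exact_mod_cast Nat.le_succ m))
    have hd : Differentiable ℝ (iteratedDeriv m f) :=
      hf.differentiable_iteratedDeriv m (by exact_mod_cast Nat.lt_succ_self m)
    have hc : Continuous (iteratedDeriv (m+1) f) :=
      hf.continuous_iteratedDeriv (m+1) le_rfl
    have := fourierCoeffOn_of_hasDerivAt two_pi_pos' (f := iteratedDeriv m f)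
      (f' := iteratedDeriv (m+1) f) hn (fun x _ => by
        rw [iteratedDeriv_succ]; exact (hd x).hasDerivAt) (hc.intervalIntegrable _ _)
    have hpp : iteratedDeriv m f (2 * Real.pi) = iteratedDeriv m f 0 := by
      have := per_deriv hp m 0
      rwa [zero_add] at this
    rw [hpp, sub_self, mul_zero, zero_sub, ← fcR_eq, ← fcR_eq] at this
    rw [this] at h1
    rw [pow_succ, mul_right_comm, ← h1]
    simp only [norm_mul, norm_div, norm_neg]
    have hn' : |(n:ℝ)| ≠ 0 := by simpa using hn
    simp [Real.pi_pos.le, abs_of_nonneg]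
    field_simp

lemma holder_block {g : ℝ → ℂ} (hg : Continuous g) (hp : Function.Periodic g (2 * Real.pi))
    {S α : ℝ} (hS : ∀ t h : ℝ, 0 < h → h ≤ Real.pi → ‖g (t + h) - g t‖ ≤ S * h ^ α) (k : ℕ) :
    ∑ n ∈ Finset.Ico (2 ^ k) (2 ^ (k + 1)), ‖fourierCoeffR g (n : ℕ)‖ ^ 2 ≤
      (S * (Real.pi / 2 ^ (k + 1)) ^ α) ^ 2 := by
  set h : ℝ := Real.pi / 2 ^ (k + 1) with hh
  have h0 : 0 < h := by positivity
  have h1 : h ≤ Real.pi := div_le_self Real.pi_pos.le (one_le_pow₀ (by norm_num))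
  have hb := bessel (f := fun t => g (t + h) - g t) (by fun_prop) (fun t => hS t h h0 h1)
    ((Finset.Ico (2 ^ k) (2 ^ (k + 1))).map Nat.castEmbedding)
  rw [Finset.sum_map] at hb
  refine le_trans (Finset.sum_le_sum fun n hn => ?_) hb
  rw [Finset.mem_Ico] at hn
  simp only [Nat.castEmbedding_apply]
  rw [fcR_sub (by fun_prop) hg, fcR_shift hp, ← sub_one_mul, norm_mul, mul_pow]
  refine le_mul_of_one_le_left (by positivity) ?_
  rw [Complex.norm_exp_I_mul_ofReal_sub_one, Real.norm_eq_abs, sq_abs]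
  have hn1 : (2:ℝ) ^ k ≤ n := by exact_mod_cast hn.1
  have hn2 : (n:ℝ) ≤ 2 ^ (k + 1) := by exact_mod_cast hn.2.le
  set θ : ℝ := ((n : ℕ) : ℤ) * h with hθ
  have e1 : Real.pi / 2 ≤ θ := by
    rw [hθ, hh, pow_succ]
    push_cast
    rw [← mul_div_assoc, div_le_div_iff₀ (by norm_num) (by positivity)]
    nlinarith [Real.pi_pos]
  have e2 : θ ≤ Real.pi := by
    rw [hθ, hh]
    push_cast
    rw [← mul_div_assoc, div_le_iff₀ (by positivity)]
    nlinarith [Real.pi_pos]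
  have hc : Real.cos θ ≤ 0 := Real.cos_nonpos_of_pi_div_two_le_of_le e1 (by linarith [Real.pi_pos])
  have := Real.cos_two_mul (θ / 2)
  rw [mul_div_cancel₀ θ (two_ne_zero)] at this
  have := Real.sin_sq_add_cos_sq (θ / 2)
  nlinarith

lemma block_bound {f : ℝ → ℂ} {m : ℕ} (hp : Function.Periodic f (2 * Real.pi))
    (hf : ContDiff ℝ m f) {S α s ε : ℝ} (hs : 0 ≤ s) (hS0 : 0 ≤ S) (hα0 : 0 ≤ α) (hα : α ≤ 1)
    (hsm : s + 1/2 + ε = m + α)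
    (hS : ∀ t h : ℝ, 0 < h → h ≤ Real.pi →
      ‖iteratedDeriv m f (t + h) - iteratedDeriv m f t‖ ≤ S * h ^ α) (k : ℕ) :
    ∑ n ∈ Finset.Ico (2 ^ k) (2 ^ (k + 1)), ‖fourierCoeffR f (n : ℕ)‖ * (1 + (n:ℝ)) ^ s ≤
      2 ^ s * Real.pi * S * ((2:ℝ) ^ (-ε)) ^ k := by
  have hB := holder_block (hf.continuous_iteratedDeriv m le_rfl) (per_deriv hp m) hS k
  set B : ℝ := S * (Real.pi / 2 ^ (k + 1)) ^ α with hBdef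
  have hB0 : 0 ≤ B := by positivity
  set x : ℝ := 2 ^ k with hx
  have hx0 : 0 < x := by positivity
  have hBx : B ≤ S * Real.pi * x ^ (-α) := by
    have e : Real.pi / 2 ^ (k + 1) = (Real.pi / 2) * x⁻¹ := by
      rw [hx, pow_succ]; field_simp
    rw [hBdef, e, Real.mul_rpow (by positivity) (by positivity), Real.inv_rpow hx0.le,
      ← Real.rpow_neg hx0.le, mul_assoc]
    have : (Real.pi / 2) ^ α ≤ Real.pi := by
      calc (Real.pi / 2) ^ α ≤ (Real.pi / 2) ^ (1:ℝ) :=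
            Real.rpow_le_rpow_of_exponent_le (by linarith [Real.pi_gt_three]) hα
        _ ≤ Real.pi := by rw [Real.rpow_one]; linarith [Real.pi_pos]
    gcongr
  have hsum : ∑ n ∈ Finset.Ico (2 ^ k) (2 ^ (k + 1)),
      ‖fourierCoeffR (iteratedDeriv m f) (n : ℕ)‖ ≤ x ^ (1/2 : ℝ) * B := by
    have h := sq_sum_le_card_mul_sum_sq (s := Finset.Ico (2 ^ k) (2 ^ (k + 1)))
      (f := fun n : ℕ => ‖fourierCoeffR (iteratedDeriv m f) (n : ℕ)‖)
    have hcard : (((Finset.Ico (2 ^ k) (2 ^ (k + 1))).card : ℕ) : ℝ) = x := by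
      rw [Nat.card_Ico, pow_succ, hx]
      have : 2 ^ k * 2 - 2 ^ k = 2 ^ k := by omega
      rw [this]; push_cast; rfl
    rw [hcard] at h
    refine abs_le_of_sq_le_sq' ?_ (by positivity) |>.2
    refine h.trans ?_
    rw [mul_pow, ← Real.rpow_natCast (x ^ (1/2:ℝ)), ← Real.rpow_mul hx0.le]
    norm_num
    exact mul_le_mul_of_nonneg_left hB hx0.le
  have hterm : ∀ n ∈ Finset.Ico (2 ^ k) (2 ^ (k + 1)),
      ‖fourierCoeffR f (n : ℕ)‖ * (1 + (n:ℝ)) ^ s ≤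
      (2 * x) ^ s * x ^ (-(m:ℝ)) * ‖fourierCoeffR (iteratedDeriv m f) (n : ℕ)‖ := by
    intro n hn
    rw [Finset.mem_Ico] at hn
    have hn1 : x ≤ n := by rw [hx]; exact_mod_cast hn.1
    have hn2 : 1 + (n:ℝ) ≤ 2 * x := by
      rw [hx, ← pow_succ']
      have : 1 + n ≤ 2 ^ (k+1) := by omega
      exact_mod_cast this
    have hn0 : ((n : ℕ) : ℤ) ≠ 0 := by
      have := Nat.pos_of_ne_zero (pow_ne_zero k (two_ne_zero (α := ℕ)))
      omega
    rw [fcR_deriv hp hf hn0]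
    have e1 : (1 + (n:ℝ)) ^ s ≤ (2 * x) ^ s := Real.rpow_le_rpow (by positivity) hn2 hs
    have e2 : 1 ≤ x ^ (-(m:ℝ)) * |(((n:ℕ):ℤ):ℝ)| ^ m := by
      rw [Real.rpow_neg hx0.le, Real.rpow_natCast, inv_mul_eq_div, one_le_div (by positivity)]
      push_cast
      rw [abs_of_nonneg (by positivity)]
      gcongr
    calc _ ≤ ‖fourierCoeffR f (n : ℕ)‖ * (2 * x) ^ s * 1 := by rw [mul_one]; gcongr
      _ ≤ ‖fourierCoeffR f (n : ℕ)‖ * (2 * x) ^ s * (x ^ (-(m:ℝ)) * |(((n:ℕ):ℤ):ℝ)| ^ m) := by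
        gcongr
      _ = _ := by ring
  calc _ ≤ _ := Finset.sum_le_sum hterm
    _ = (2 * x) ^ s * x ^ (-(m:ℝ)) * ∑ n ∈ Finset.Ico (2 ^ k) (2 ^ (k + 1)),
      ‖fourierCoeffR (iteratedDeriv m f) (n : ℕ)‖ := by rw [Finset.mul_sum]
    _ ≤ (2 * x) ^ s * x ^ (-(m:ℝ)) * (x ^ (1/2 : ℝ) * (S * Real.pi * x ^ (-α))) := by
      refine mul_le_mul_of_nonneg_left (hsum.trans ?_) (by positivity)
      gcongr
    _ = 2 ^ s * Real.pi * S * (x ^ s * x ^ (-(m:ℝ)) * x ^ (1/2 : ℝ) * x ^ (-α)) := by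
      rw [Real.mul_rpow (by norm_num) hx0.le]; ring
    _ = _ := by
      rw [← Real.rpow_add hx0, ← Real.rpow_add hx0, ← Real.rpow_add hx0]
      have : s + -(m:ℝ) + 1/2 + -α = -ε := by linarith
      rw [this, hx, ← Real.rpow_natCast, ← Real.rpow_natCast, ← Real.rpow_mul (by norm_num),
        ← Real.rpow_mul (by norm_num), mul_comm (k:ℝ)]

lemma dyadic {a : ℕ → ℝ} (ha : ∀ n, 0 ≤ a n) {A r : ℝ} (hA : 0 ≤ A) (hr0 : 0 ≤ r) (hr : r < 1)
    (h : ∀ k : ℕ, ∑ n ∈ Finset.Ico (2 ^ k) (2 ^ (k + 1)), a n ≤ A * r ^ k) :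
    Summable a ∧ ∑' n, a n ≤ a 0 + A * (1 - r)⁻¹ := by
  have key : ∀ K : ℕ, ∑ n ∈ Finset.range (2 ^ K), a n ≤ a 0 + A * ∑ k ∈ Finset.range K, r ^ k := by
    intro K
    induction K with
    | zero => simp
    | succ K ih =>
      rw [← Finset.sum_range_add_sum_Ico _ (Nat.pow_le_pow_right two_pos (Nat.le_succ K)),
        Finset.sum_range_succ, mul_add, ← add_assoc]
      exact add_le_add ih (h K)
  have key2 : ∀ N : ℕ, ∑ n ∈ Finset.range N, a n ≤ a 0 + A * (1 - r)⁻¹ := by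
    intro N
    refine (Finset.sum_le_sum_of_subset_of_nonneg
      (Finset.range_mono (Nat.lt_two_pow_self (n := N)).le) fun i _ _ => ha i).trans ((key N).trans ?_)
    gcongr
    exact sum_le_hasSum _ (fun _ _ => by positivity) (hasSum_geometric_of_lt_one hr0 hr)
  exact ⟨summable_of_sum_range_le ha key2, Real.tsum_le_of_sum_range_le ha key2⟩

noncomputable def bernK (s ε : ℝ) : ℝ := 1 + 2 ^ s * Real.pi * (1 - (2:ℝ) ^ (-ε))⁻¹

lemma bern_main {s ε : ℝ} (hs : 0 ≤ s) (hε : 0 < ε) {f : ℝ → ℂ}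
    (hf : memLambda (s + 1/2 + ε) f) :
    Summable (fun n : ℕ => ‖fourierCoeffR f n‖ * (1 + (n:ℝ)) ^ s) ∧
    ∑' n : ℕ, ‖fourierCoeffR f n‖ * (1 + (n:ℝ)) ^ s ≤ bernK s ε * lambdaNorm (s + 1/2 + ε) f := by
  obtain ⟨hp, hd, M, hM⟩ := hf
  unfold lambdaNorm
  set σ := s + 1/2 + ε with hσ
  set m := ⌊σ⌋₊ with hm
  set S := sSup {x : ℝ | ∃ t t' : ℝ,
      Complex.exp (t * Complex.I) ≠ Complex.exp (t' * Complex.I) ∧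
      x = ‖iteratedDeriv m f t - iteratedDeriv m f t'‖ /
        ‖Complex.exp (t * Complex.I) - Complex.exp (t' * Complex.I)‖ ^ (σ - (m : ℝ))} with hSdef
  have hS0 : 0 ≤ S := by
    apply Real.sSup_nonneg
    rintro x ⟨t, t', _, rfl⟩
    positivity
  have hα0 : 0 ≤ σ - m := sub_nonneg.2 (Nat.floor_le (by positivity))
  have hα1 : σ - m ≤ 1 := by linarith [Nat.lt_floor_add_one σ]
  have hS : ∀ t h : ℝ, 0 < h → h ≤ Real.pi →
      ‖iteratedDeriv m f (t + h) - iteratedDeriv m f t‖ ≤ S * h ^ (σ - m) := by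
    intro t h h0 hpi
    have hd1 : ‖Complex.exp ((t + h : ℝ) * Complex.I) - Complex.exp (t * Complex.I)‖ =
        ‖Complex.exp (Complex.I * h) - 1‖ := by
      have : Complex.exp ((t + h : ℝ) * Complex.I) - Complex.exp (t * Complex.I) =
          Complex.exp (t * Complex.I) * (Complex.exp (Complex.I * h) - 1) := by
        rw [mul_sub, ← Complex.exp_add, mul_one]
        congr 2
        push_cast; ring
      rw [this, norm_mul, Complex.norm_exp_ofReal_mul_I, one_mul]
    have hd2 : ‖Complex.exp (Complex.I * h) - 1‖ ≤ h := by
      have := Real.norm_exp_I_mul_ofReal_sub_one_le (x := h)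
      rwa [Real.norm_of_nonneg h0.le] at this
    have hd3 : 0 < ‖Complex.exp (Complex.I * h) - 1‖ := by
      rw [Complex.norm_exp_I_mul_ofReal_sub_one]
      have := Real.sin_pos_of_pos_of_lt_pi (x := h/2) (by linarith) (by linarith)
      rw [norm_pos_iff]; positivity
    have hne : Complex.exp ((t + h : ℝ) * Complex.I) ≠ Complex.exp (t * Complex.I) := by
      rw [← sub_ne_zero, ← norm_pos_iff, hd1]; exact hd3
    have hle : ‖iteratedDeriv m f (t + h) - iteratedDeriv m f t‖ /
        ‖Complex.exp ((t + h : ℝ) * Complex.I) - Complex.exp (t * Complex.I)‖ ^ (σ - (m : ℝ)) ≤ S := by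
      apply le_csSup
      · refine ⟨M, ?_⟩
        rintro x ⟨u, u', hu, rfl⟩
        have : 0 < ‖Complex.exp (u * Complex.I) - Complex.exp (u' * Complex.I)‖ := by
          rw [norm_pos_iff]; exact sub_ne_zero.2 hu
        rw [div_le_iff₀ (by positivity)]
        exact hM u u'
      · exact ⟨t + h, t, hne, rfl⟩
    rw [hd1, div_le_iff₀ (by positivity)] at hle
    refine hle.trans ?_
    gcongr
  have hr : (2:ℝ) ^ (-ε) < 1 := Real.rpow_lt_one_of_one_lt_of_neg (by norm_num) (by linarith)
  have hr' : 0 < 1 - (2:ℝ) ^ (-ε) := by linarith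
  obtain ⟨h1, h2⟩ := dyadic (a := fun n : ℕ => ‖fourierCoeffR f n‖ * (1 + (n:ℝ)) ^ s)
    (fun n => by positivity) (A := 2 ^ s * Real.pi * S) (by positivity) (by positivity) hr
    (block_bound (ε := ε) hp hd hs hS0 hα0 hα1 (by rw [← hσ]; ring) hS)
  refine ⟨h1, h2.trans ?_⟩
  have hnn : ∀ k, 0 ≤ sSup {x : ℝ | ∃ t : ℝ, x = ‖iteratedDeriv k f t‖} := by
    intro k
    apply Real.sSup_nonneg
    rintro x ⟨t, rfl⟩
    positivity
  set N := ∑ k ∈ Finset.range (m + 1), sSup {x : ℝ | ∃ t : ℝ, x = ‖iteratedDeriv k f t‖} with hN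
  have hN0 : 0 ≤ N := Finset.sum_nonneg fun k _ => hnn k
  have hfN : ∀ t, ‖f t‖ ≤ N := by
    intro t
    refine le_trans ?_ (Finset.single_le_sum (fun k _ => hnn k) (Finset.mem_range.2 (Nat.succ_pos m)))
    apply le_csSup
    · obtain ⟨R, hR⟩ := (hp.isBounded_of_continuous two_pi_pos'.ne' hd.continuous).exists_norm_le
      refine ⟨R, ?_⟩
      rintro x ⟨u, rfl⟩
      simpa using hR (f u) ⟨u, rfl⟩
    · exact ⟨t, by simp⟩
  have h0 : ‖fourierCoeffR f 0‖ ≤ N := by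
    have := bessel hd.continuous hfN {0}
    rw [Finset.sum_singleton] at this
    exact (abs_le_of_sq_le_sq' this hN0).2
  have hP : 0 ≤ 2 ^ s * Real.pi * (1 - (2:ℝ) ^ (-ε))⁻¹ := by positivity
  simp only [Nat.cast_zero, add_zero, Real.one_rpow, mul_one, bernK]
  have e := mul_nonneg hP hN0
  have h0' : ‖fourierCoeffR f ((0:ℕ):ℤ)‖ ≤ N := by simpa using h0
  simp only [Nat.cast_zero] at h0'
  nlinarith

lemma exp_ortho (k n : ℕ) :
    ∫ t in (0:ℝ)..(2 * Real.pi), Complex.exp (k * t * Complex.I) *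
      Complex.exp (-((n : ℤ) : ℂ) * t * Complex.I) = if k = n then (2 * Real.pi : ℂ) else 0 := by
  have h : ∀ t : ℝ, Complex.exp (k * t * Complex.I) *
      Complex.exp (-((n : ℤ) : ℂ) * t * Complex.I) =
      Complex.exp ((((k:ℂ) - n) * Complex.I) * t) := by
    intro t
    rw [← Complex.exp_add]; congr 1; push_cast; ring
  simp_rw [h]
  split_ifs with hkn
  · simp [hkn]
  · have : ((k:ℂ) - n) * Complex.I ≠ 0 := by
      refine mul_ne_zero (sub_ne_zero.2 ?_) Complex.I_ne_zero
      exact_mod_cast hkn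
    rw [integral_exp_mul_complex this]
    have e : Complex.exp (((k:ℂ) - n) * Complex.I * ((2 * Real.pi : ℝ) : ℂ)) = 1 := by
      rw [Complex.exp_eq_one_iff]
      exact ⟨(k:ℤ) - n, by push_cast; ring⟩
    rw [e]; simp

lemma coeff_unique {c : ℕ → ℂ} (hc : Summable fun n => ‖c n‖) {f : ℝ → ℂ}
    (hf : ∀ t : ℝ, HasSum (fun k : ℕ => c k * Complex.exp (k * t * Complex.I)) (f t)) (n : ℕ) :
    fourierCoeffR f n = c n := by
  have hn : ∀ (z : ℝ), ‖Complex.exp (z * Complex.I)‖ = 1 := Complex.norm_exp_ofReal_mul_I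
  have hs := intervalIntegral.hasSum_integral_of_dominated_convergence
    (μ := MeasureTheory.volume) (a := 0) (b := 2 * Real.pi)
    (F := fun (k : ℕ) (t : ℝ) => c k * Complex.exp (k * t * Complex.I) *
      Complex.exp (-((n : ℤ) : ℂ) * t * Complex.I))
    (f := fun t => f t * Complex.exp (-((n : ℤ) : ℂ) * t * Complex.I))
    (fun k _ => ‖c k‖)
    (fun k => Continuous.aestronglyMeasurable (by fun_prop))
    (fun k => Filter.Eventually.of_forall fun t _ => by
      have e1 := hn (k * t)
      have e2 := hn (-(n:ℤ) * t)
      push_cast at e1 e2 ⊢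
      rw [norm_mul, norm_mul, e1, e2]; simp)
    (Filter.Eventually.of_forall fun t _ => hc)
    (by simp)
    (Filter.Eventually.of_forall fun t _ => (hf t).mul_right _)
  simp_rw [mul_assoc (c _)] at hs
  simp_rw [intervalIntegral.integral_const_mul, exp_ortho] at hs
  have h2 := hasSum_single (f := fun k : ℕ => c k * if k = n then (2 * Real.pi : ℂ) else 0) n
    (fun k hk => by simp [hk])
  have := hs.unique h2
  simp only [fourierCoeffR]
  rw [this]
  have : (Real.pi : ℂ) ≠ 0 := by exact_mod_cast Real.pi_ne_zero
  simp
  field_simp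

lemma fourier_series {f : ℝ → ℂ} (hp : Function.Periodic f (2 * Real.pi)) (hc : Continuous f)
    (hneg : ∀ n : ℤ, n < 0 → fourierCoeffR f n = 0)
    (hs : Summable fun n : ℕ => ‖fourierCoeffR f n‖) (t : ℝ) :
    HasSum (fun k : ℕ => fourierCoeffR f k * Complex.exp (k * t * Complex.I)) (f t) := by
  haveI : Fact (0 < 2 * Real.pi) := ⟨two_pi_pos'⟩
  let F : C(AddCircle (2 * Real.pi), ℂ) := ⟨hp.lift, continuous_coinduced_dom.mpr hc⟩
  have hF : ∀ x : ℝ, F (x : AddCircle (2 * Real.pi)) = f x := fun x => hp.lift_coe x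
  have hcoef : ∀ n, fourierCoeff F n = fourierCoeffR f n := by
    intro n
    rw [fcR_eq, fourierCoeffOn_eq_integral, fourierCoeff_eq_intervalIntegral _ _ 0]
    simp only [hF, zero_add, fourier_coe_apply, sub_zero]
  have hinj : Function.Injective (Nat.cast : ℕ → ℤ) := Nat.cast_injective
  have hout : ∀ x : ℤ, x ∉ Set.range (Nat.cast : ℕ → ℤ) → fourierCoeffR f x = 0 := by
    intro x hx
    apply hneg
    by_contra h
    exact hx ⟨x.toNat, by omega⟩
  have hsum : Summable (fourierCoeff F) := by
    have : fourierCoeff F = fourierCoeffR f := funext hcoef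
    rw [this, ← hinj.summable_iff hout]
    exact hs.of_norm
  have h := has_pointwise_sum_fourier_series_of_summable hsum (t : AddCircle (2 * Real.pi))
  rw [hF, ← hinj.hasSum_iff (fun x hx => by rw [hcoef, hout x hx, zero_smul])] at h
  convert h using 2 with k
  simp only [Function.comp, hcoef, smul_eq_mul, fourier_coe_apply]
  congr 2
  have : (Real.pi : ℂ) ≠ 0 := by exact_mod_cast Real.pi_ne_zero
  push_cast
  field_simp

lemma fcR_mul {f g : ℝ → ℂ} (hf : ∀ t : ℝ, HasSum (fun k : ℕ => fourierCoeffR f k * Complex.exp (k * t * Complex.I)) (f t))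
    (hg : ∀ t : ℝ, HasSum (fun k : ℕ => fourierCoeffR g k * Complex.exp (k * t * Complex.I)) (g t))
    (hsf : Summable fun n : ℕ => ‖fourierCoeffR f n‖)
    (hsg : Summable fun n : ℕ => ‖fourierCoeffR g n‖) (n : ℕ) :
    fourierCoeffR (f * g) n =
      ∑ kl ∈ Finset.HasAntidiagonal.antidiagonal n, fourierCoeffR f kl.1 * fourierCoeffR g kl.2 := by
  refine coeff_unique (c := fun n => ∑ kl ∈ Finset.HasAntidiagonal.antidiagonal n,
    fourierCoeffR f kl.1 * fourierCoeffR g kl.2)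
    (summable_norm_sum_mul_antidiagonal_of_summable_norm
      (f := fun n : ℕ => fourierCoeffR f n) (g := fun n : ℕ => fourierCoeffR g n) hsf hsg) (fun t => ?_) n
  have hn : ∀ (k : ℕ), ‖Complex.exp (k * t * Complex.I)‖ = 1 := fun k => by
    have := Complex.norm_exp_ofReal_mul_I (k * t)
    push_cast at this; exact this
  have hsf' : Summable fun k : ℕ => ‖fourierCoeffR f k * Complex.exp (k * t * Complex.I)‖ := by
    simpa [hn] using hsf
  have hsg' : Summable fun k : ℕ => ‖fourierCoeffR g k * Complex.exp (k * t * Complex.I)‖ := by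
    simpa [hn] using hsg
  have h1 := tsum_mul_tsum_eq_tsum_sum_antidiagonal_of_summable_norm hsf' hsg'
  have h2 := (summable_norm_sum_mul_antidiagonal_of_summable_norm hsf' hsg').of_norm.hasSum
  rw [← h1, (hf t).tsum_eq, (hg t).tsum_eq] at h2
  suffices hfun : ∀ k : ℕ, (∑ kl ∈ Finset.HasAntidiagonal.antidiagonal k,
      fourierCoeffR f kl.1 * fourierCoeffR g kl.2) * Complex.exp (k * t * Complex.I) =
      ∑ kl ∈ Finset.HasAntidiagonal.antidiagonal k,
        fourierCoeffR f kl.1 * Complex.exp (kl.1 * t * Complex.I) *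
          (fourierCoeffR g kl.2 * Complex.exp (kl.2 * t * Complex.I)) by
    simp only [hfun]
    exact h2
  intro k
  rw [Finset.sum_mul]
  refine Finset.sum_congr rfl fun kl hkl => ?_
  rw [← Finset.HasAntidiagonal.mem_antidiagonal.1 hkl]
  have : Complex.exp (((kl.1 + kl.2 : ℕ) : ℂ) * t * Complex.I) =
      Complex.exp (kl.1 * t * Complex.I) * Complex.exp (kl.2 * t * Complex.I) := by
    rw [← Complex.exp_add]; congr 1; push_cast; ring
  rw [this]; ring

lemma fcR_exp (j n : ℕ) :
    fourierCoeffR (fun t : ℝ => Complex.exp (j * t * Complex.I)) n = if n = j then 1 else 0 := by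
  refine coeff_unique (c := fun n => if n = j then 1 else 0) ?_ (fun t => ?_) n
  · refine summable_of_ne_finset_zero (s := {j}) fun b hb => ?_
    simp at hb; simp [hb]
  · have h2 := hasSum_single (f := fun k : ℕ => (if k = j then (1:ℂ) else 0) *
      Complex.exp (k * t * Complex.I)) j (fun k hk => by simp [hk])
    simpa using h2

/-- An operator with `‖Tⁿ‖ = O(n^s)` admits a continuous `Λ_{s+1/2+ε}^+(𝕋)` functional
calculus `Φ(f) = ∑_{n≥0} f̂(n) Tⁿ`. -/
theorem stmt14 (s ε : ℝ) (hs : 0 ≤ s) (hε : 0 < ε)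
    (X : Type) [NormedAddCommGroup X] [NormedSpace ℂ X] [CompleteSpace X]
    (T : X →L[ℂ] X) (C : ℝ) (hC : 0 < C)
    (hT : ∀ n : ℕ, ‖T ^ n‖ ≤ C * (1 + (n : ℝ)) ^ s) :
    let Φ : (ℝ → ℂ) → (X →L[ℂ] X) := fun f => ∑' n : ℕ, fourierCoeffR f n • T ^ n
    (∃ C' > 0, ∀ f : ℝ → ℂ, memLambdaPlus (s + 1/2 + ε) f →
        HasSum (fun n : ℕ => fourierCoeffR f n • T ^ n) (Φ f) ∧
        ‖Φ f‖ ≤ C' * lambdaNorm (s + 1/2 + ε) f) ∧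
    (∀ f g : ℝ → ℂ, memLambdaPlus (s + 1/2 + ε) f → memLambdaPlus (s + 1/2 + ε) g →
        Φ (f + g) = Φ f + Φ g) ∧
    (∀ (c : ℂ) (f : ℝ → ℂ), memLambdaPlus (s + 1/2 + ε) f → Φ (c • f) = c • Φ f) ∧
    (∀ f g : ℝ → ℂ, memLambdaPlus (s + 1/2 + ε) f → memLambdaPlus (s + 1/2 + ε) g →
        Φ (f * g) = Φ f * Φ g) ∧
    Φ (fun _ => 1) = 1 ∧
    Φ (fun t : ℝ => Complex.exp (t * Complex.I)) = T := by
  intro Φ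
  have hnorm : ∀ f : ℝ → ℂ, ∀ n : ℕ, ‖fourierCoeffR f n • T ^ n‖ ≤
      C * (‖fourierCoeffR f n‖ * (1 + (n:ℝ)) ^ s) := by
    intro f n
    rw [norm_smul]
    calc _ ≤ ‖fourierCoeffR f n‖ * (C * (1 + (n:ℝ)) ^ s) := by gcongr; exact hT n
      _ = _ := by ring
  have hB := fun (f : ℝ → ℂ) (hf : memLambdaPlus (s + 1/2 + ε) f) => bern_main hs hε hf.1
  have hsn : ∀ f : ℝ → ℂ, memLambdaPlus (s + 1/2 + ε) f →
      Summable fun n : ℕ => ‖fourierCoeffR f n • T ^ n‖ := fun f hf =>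
    Summable.of_nonneg_of_le (fun _ => norm_nonneg _) (hnorm f) ((hB f hf).1.mul_left C)
  have hsc : ∀ f : ℝ → ℂ, memLambdaPlus (s + 1/2 + ε) f →
      Summable fun n : ℕ => ‖fourierCoeffR f n‖ := fun f hf =>
    Summable.of_nonneg_of_le (fun _ => norm_nonneg _) (fun n =>
      le_mul_of_one_le_right (norm_nonneg _) (Real.one_le_rpow (by simp) hs)) (hB f hf).1
  have hcont : ∀ f : ℝ → ℂ, memLambdaPlus (s + 1/2 + ε) f → Continuous f :=
    fun f hf => hf.1.2.1.continuous
  have hfs := fun (f : ℝ → ℂ) (hf : memLambdaPlus (s + 1/2 + ε) f) =>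
    fourier_series hf.1.1 (hcont f hf) hf.2 (hsc f hf)
  have hK : 0 < bernK s ε := by
    have hr : (2:ℝ) ^ (-ε) < 1 := Real.rpow_lt_one_of_one_lt_of_neg (by norm_num) (by linarith)
    have hr' : 0 < 1 - (2:ℝ) ^ (-ε) := by linarith
    unfold bernK; positivity
  have hexp : ∀ j : ℕ, Φ (fun t : ℝ => Complex.exp (j * t * Complex.I)) = T ^ j := by
    intro j
    simp only [Φ, fcR_exp]
    rw [tsum_eq_single j (fun k hk => by simp [hk])]
    simp
  refine ⟨⟨C * bernK s ε, by positivity, fun f hf => ⟨(hsn f hf).of_norm.hasSum, ?_⟩⟩,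
    ?_, ?_, ?_, ?_, ?_⟩
  · calc ‖Φ f‖ ≤ ∑' n : ℕ, ‖fourierCoeffR f n • T ^ n‖ := norm_tsum_le_tsum_norm (hsn f hf)
      _ ≤ ∑' n : ℕ, C * (‖fourierCoeffR f n‖ * (1 + (n:ℝ)) ^ s) :=
        (hsn f hf).tsum_le_tsum (hnorm f) ((hB f hf).1.mul_left C)
      _ = C * ∑' n : ℕ, ‖fourierCoeffR f n‖ * (1 + (n:ℝ)) ^ s := tsum_mul_left
      _ ≤ C * (bernK s ε * lambdaNorm (s + 1/2 + ε) f) := by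
        gcongr; exact (hB f hf).2
      _ = _ := by ring
  · intro f g hf hg
    simp only [Φ, fcR_add (hcont f hf) (hcont g hg), add_smul]
    exact (hsn f hf).of_norm.tsum_add (hsn g hg).of_norm
  · intro c f hf
    simp only [Φ, fcR_smul, mul_smul]
    exact (hsn f hf).of_norm.tsum_const_smul c
  · intro f g hf hg
    simp only [Φ, fcR_mul (hfs f hf) (hfs g hg) (hsc f hf) (hsc g hg)]
    rw [tsum_mul_tsum_eq_tsum_sum_antidiagonal_of_summable_norm (hsn f hf) (hsn g hg)]
    refine tsum_congr fun n => ?_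
    rw [Finset.sum_smul]
    refine Finset.sum_congr rfl fun kl hkl => ?_
    rw [← Finset.HasAntidiagonal.mem_antidiagonal.1 hkl, pow_add, smul_mul_smul_comm]
  · simpa using hexp 0
  · simpa using hexp 1
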